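/- Let (Ω, 𝒜, P) be a complete probability space without atoms, E a real Banach space, and F : Ω → ℭ(E) strongly measurable with ∫_Ω ‖F‖ dP < ∞. Then the Aumann integral of F over Ω equals the Aumann integral of the map ω ↦ co̅F(ω) over Ω, where co̅F(ω) is the closed convex hull of F(ω); that is, the closure of { ∫_Ω f dP : f a Bochner-integrable measurable selection of F } equals the closure of { ∫_Ω g dP : g a Bochner-integrable measurable selection of ω ↦ co̅F(ω) }. -/

import Mathlib

open Metric Filter Topology MeasureTheory Pointwise

variable {Ω : Type*} [MeasurableSpace Ω]
variable {E : Type*} [NormedAddCommGroup E] [NormedSpace ℝ E] [CompleteSpace E]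

/-- The excess `e(A,B) = sup_{a ∈ A} d(a, B)`. -/
noncomputable def excess (A B : Set E) : ℝ := sSup ((fun a => infDist a B) '' A)

/-- The Pompeiu–Hausdorff distance `h(A,B) = max (e(A,B)) (e(B,A))`. -/
noncomputable def hdist (A B : Set E) : ℝ := max (excess A B) (excess B A)

/-- Membership in `ℭ(E)`: nonempty, closed and bounded. -/
def IsCB (A : Set E) : Prop := A.Nonempty ∧ IsClosed A ∧ Bornology.IsBounded A

/-- A map is countably-valued if it is constant on each piece of a countable measurable
partition of `Ω`. -/
def CountablyValued {α : Type*} (g : Ω → α) : Prop :=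
  ∃ (P : ℕ → Set Ω) (a : ℕ → α),
    (∀ i, MeasurableSet (P i)) ∧ Pairwise (Function.onFun Disjoint P) ∧
    (⋃ i, P i) = Set.univ ∧ ∀ i, ∀ ω ∈ P i, g ω = a i

/-- A set-valued map `F : Ω → ℭ(E)` is strongly measurable if some sequence of
countably-valued maps with values in `ℭ(E)` converges to it uniformly almost surely in
the Pompeiu–Hausdorff metric. -/
def SMeasurableSet (μ : Measure Ω) (F : Ω → Set E) : Prop :=
  ∃ G : ℕ → Ω → Set E,
    (∀ n, CountablyValued (G n)) ∧ (∀ n ω, IsCB (G n ω)) ∧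
    ∀ ε : ℝ, 0 < ε → ∃ N : ℕ, ∀ n ≥ N, ∀ᵐ ω ∂μ, hdist (G n ω) (F ω) ≤ ε

/-- A single-valued map `f : Ω → E` is measurable (in the sense of Hille–Phillips) if
some sequence of countably-valued maps converges to it uniformly almost surely. -/
def PMeasurable (μ : Measure Ω) (f : Ω → E) : Prop :=
  ∃ g : ℕ → Ω → E, (∀ n, CountablyValued (g n)) ∧
    ∀ ε : ℝ, 0 < ε → ∃ N : ℕ, ∀ n ≥ N, ∀ᵐ ω ∂μ, ‖g n ω - f ω‖ ≤ ε

/-- A measure is atomless if every measurable set of positive measure contains a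
measurable subset of strictly smaller positive measure. -/
def Atomless (μ : Measure Ω) : Prop :=
  ∀ A : Set Ω, MeasurableSet A → 0 < μ A →
    ∃ B ⊆ A, MeasurableSet B ∧ 0 < μ B ∧ μ B < μ A

/-! ### Sierpiński's theorem on the range of an atomless measure -/

lemma Atomless.exists_subset_real_le_half {μ : Measure Ω} [IsFiniteMeasure μ] (hμ : Atomless μ)
    {A : Set Ω} (hA : MeasurableSet A) (hpos : 0 < μ.real A) :
    ∃ B ⊆ A, MeasurableSet B ∧ 0 < μ.real B ∧ μ.real B ≤ μ.real A / 2 := by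
  obtain ⟨B, hBA, hB, hB0, hBlt⟩ := hμ A hA (ENNReal.toReal_pos_iff.1 hpos).1
  have hB0' : 0 < μ.real B := ENNReal.toReal_pos hB0.ne' (measure_ne_top _ _)
  have hBlt' : μ.real B < μ.real A := (ENNReal.toReal_lt_toReal (by simp) (by simp)).2 hBlt
  have hd : μ.real (A \ B) = μ.real A - μ.real B := measureReal_sdiff hBA hB
  rcases le_total (μ.real B) (μ.real A / 2) with h | h
  · exact ⟨B, hBA, hB, hB0', h⟩
  · exact ⟨A \ B, Set.sdiff_subset, hA.diff hB, by linarith, by linarith⟩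

lemma Atomless.exists_subset_real_le {μ : Measure Ω} [IsFiniteMeasure μ] (hμ : Atomless μ)
    {A : Set Ω} (hA : MeasurableSet A) (hpos : 0 < μ.real A) {ε : ℝ} (hε : 0 < ε) :
    ∃ B ⊆ A, MeasurableSet B ∧ 0 < μ.real B ∧ μ.real B ≤ ε := by
  have key : ∀ n : ℕ, ∃ B ⊆ A, MeasurableSet B ∧ 0 < μ.real B ∧ μ.real B ≤ μ.real A / 2 ^ n := by
    intro n
    induction n with
    | zero => exact ⟨A, subset_rfl, hA, hpos, by simp⟩
    | succ n ih =>
      obtain ⟨B, hBA, hB, hB0, hBn⟩ := ih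
      obtain ⟨C, hCB, hC, hC0, hCn⟩ := hμ.exists_subset_real_le_half hB hB0
      refine ⟨C, hCB.trans hBA, hC, hC0, hCn.trans ?_⟩
      rw [pow_succ, ← div_div]
      gcongr
  have hlim : Tendsto (fun n : ℕ => μ.real A / 2 ^ n) atTop (𝓝 0) :=
    tendsto_const_nhds.div_atTop (tendsto_pow_atTop_atTop_of_one_lt one_lt_two)
  obtain ⟨n, hn⟩ := (hlim.eventually (ge_mem_nhds hε)).exists
  obtain ⟨B, hBA, hB, hB0, hBn⟩ := key n
  exact ⟨B, hBA, hB, hB0, hBn.trans hn⟩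

lemma exists_superset_real_half_sup (μ : Measure Ω) [IsFiniteMeasure μ] {A B : Set Ω} {t : ℝ}
    (hB : MeasurableSet B) (hBA : B ⊆ A) (hBt : μ.real B ≤ t) :
    ∃ B', MeasurableSet B' ∧ B' ⊆ A ∧ μ.real B' ≤ t ∧ B ⊆ B' ∧
      ∀ D, MeasurableSet D → D ⊆ A \ B → μ.real B + μ.real D ≤ t →
        μ.real D ≤ 2 * (μ.real B' - μ.real B) := by
  set S : Set ℝ := {r | ∃ D, MeasurableSet D ∧ D ⊆ A \ B ∧ μ.real B + μ.real D ≤ t ∧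
    μ.real D = r} with hS
  have hbdd : BddAbove S := by
    refine ⟨t, ?_⟩
    rintro r ⟨D, -, -, h, rfl⟩
    linarith [measureReal_nonneg (μ := μ) (s := B)]
  have hne : S.Nonempty := ⟨0, ∅, by simp, by simp, by simpa using hBt, by simp⟩
  by_cases h0 : 0 < sSup S
  · obtain ⟨r, ⟨C, hC, hCA, hCt, rfl⟩, hr⟩ := exists_lt_of_lt_csSup hne (half_lt_self h0)
    have hBC : Disjoint B C := (Set.disjoint_sdiff_right).mono_right hCA
    have hu : μ.real (B ∪ C) = μ.real B + μ.real C := measureReal_union hBC hC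
    refine ⟨B ∪ C, hB.union hC, Set.union_subset hBA (hCA.trans Set.sdiff_subset), by linarith,
      Set.subset_union_left, fun D hD hDA hDt => ?_⟩
    have := le_csSup hbdd (show μ.real D ∈ S from ⟨D, hD, hDA, hDt, rfl⟩)
    linarith
  · refine ⟨B, hB, hBA, hBt, subset_rfl, fun D hD hDA hDt => ?_⟩
    have := le_csSup hbdd (show μ.real D ∈ S from ⟨D, hD, hDA, hDt, rfl⟩)
    linarith

/-- Sierpiński's theorem: an atomless finite measure takes all intermediate values. -/
theorem Atomless.exists_subset_real_eq {μ : Measure Ω} [IsFiniteMeasure μ] (hμ : Atomless μ)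
    {A : Set Ω} (hA : MeasurableSet A) {t : ℝ} (ht0 : 0 ≤ t) (htA : t ≤ μ.real A) :
    ∃ B ⊆ A, MeasurableSet B ∧ μ.real B = t := by
  have step : ∀ B : {B : Set Ω // MeasurableSet B ∧ B ⊆ A ∧ μ.real B ≤ t},
      ∃ B' : {B : Set Ω // MeasurableSet B ∧ B ⊆ A ∧ μ.real B ≤ t}, B.1 ⊆ B'.1 ∧
        ∀ D, MeasurableSet D → D ⊆ A \ B.1 → μ.real B.1 + μ.real D ≤ t →
          μ.real D ≤ 2 * (μ.real B'.1 - μ.real B.1) := by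
    rintro ⟨B, hB, hBA, hBt⟩
    obtain ⟨B', h1, h2, h3, h4⟩ := exists_superset_real_half_sup μ hB hBA hBt
    exact ⟨⟨B', h1, h2, h3⟩, h4⟩
  choose next hsub hnext using step
  set b : ℕ → {B : Set Ω // MeasurableSet B ∧ B ⊆ A ∧ μ.real B ≤ t} :=
    fun n => next^[n] ⟨∅, by simp, by simp, by simpa using ht0⟩ with hb
  have hbs : ∀ n, b (n + 1) = next (b n) := fun n => Function.iterate_succ_apply' _ _ _
  have hmono : Monotone fun n => (b n).1 :=
    monotone_nat_of_le_succ fun n => by rw [hbs]; exact hsub _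
  set U : Set Ω := ⋃ n, (b n).1 with hU
  have hUm : MeasurableSet U := .iUnion fun n => (b n).2.1
  have hUA : U ⊆ A := Set.iUnion_subset fun n => (b n).2.2.1
  have hlim : Tendsto (fun n => μ.real (b n).1) atTop (𝓝 (μ.real U)) :=
    (ENNReal.tendsto_toReal (measure_ne_top μ U)).comp (tendsto_measure_iUnion_atTop hmono)
  have hUt : μ.real U ≤ t := le_of_tendsto' hlim fun n => (b n).2.2.2
  refine ⟨U, hUA, hUm, hUt.antisymm (le_of_not_gt fun hlt => ?_)⟩
  have hd : μ.real (A \ U) = μ.real A - μ.real U := measureReal_sdiff hUA hUm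
  obtain ⟨D, hDA, hD, hD0, hDt⟩ :=
    hμ.exists_subset_real_le (hA.diff hUm) (by linarith) (sub_pos.2 hlt)
  have hle : ∀ n, μ.real D ≤ 2 * (μ.real (b (n + 1)).1 - μ.real (b n).1) := by
    intro n
    have hbU : (b n).1 ⊆ U := Set.subset_iUnion (fun n => (b n).1) n
    rw [hbs]
    refine hnext _ D hD (hDA.trans (Set.sdiff_subset_sdiff_right hbU)) ?_
    linarith [measureReal_mono (μ := μ) hbU]
  have hlim0 : Tendsto (fun n => 2 * (μ.real (b (n + 1)).1 - μ.real (b n).1)) atTop (𝓝 0) := by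
    simpa using ((hlim.comp (tendsto_add_atTop_nat 1)).sub hlim).const_mul 2
  linarith [ge_of_tendsto' hlim0 hle]

/-! ### Countably-valued maps -/

lemma countablyValued_iff {α : Type*} {g : Ω → α} :
    CountablyValued g ↔ ∃ (c : Ω → ℕ) (a : ℕ → α), Measurable c ∧ ∀ ω, g ω = a (c ω) := by
  constructor
  · rintro ⟨P, a, hP, hd, hU, hg⟩
    have hex : ∀ ω, ∃ i, ω ∈ P i := fun ω => Set.mem_iUnion.1 (hU ▸ Set.mem_univ ω)
    choose c hc using hex
    refine ⟨c, a, measurable_to_countable' fun i => ?_, fun ω => hg _ _ (hc ω)⟩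
    convert hP i using 1
    ext ω
    refine ⟨fun h => ?_, fun h => ?_⟩
    · exact (show c ω = i from h) ▸ hc ω
    · by_contra hne
      exact Set.disjoint_left.1 (hd hne) (hc ω) h
  · rintro ⟨c, a, hc, hg⟩
    refine ⟨fun i => c ⁻¹' {i}, a, fun i => hc (measurableSet_singleton i), fun i j hij => ?_, ?_,
      fun i ω h => ?_⟩
    · exact Disjoint.preimage _ (by simpa using hij)
    · ext ω; simp
    · rw [hg, show c ω = i from h]

lemma CountablyValued.const {α : Type*} (a : α) : CountablyValued fun _ : Ω => a :=
  countablyValued_iff.2 ⟨fun _ => 0, fun _ => a, measurable_const, fun _ => rfl⟩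

lemma CountablyValued.map₂ {α β γ : Type*} {f : Ω → α} {g : Ω → β} (hf : CountablyValued f)
    (hg : CountablyValued g) (φ : α → β → γ) : CountablyValued fun ω => φ (f ω) (g ω) := by
  obtain ⟨c, a, hc, hf⟩ := countablyValued_iff.1 hf
  obtain ⟨d, b, hd, hg⟩ := countablyValued_iff.1 hg
  refine countablyValued_iff.2 ⟨fun ω => Nat.pair (c ω) (d ω),
    fun n => φ (a n.unpair.1) (b n.unpair.2), ?_, fun ω => by simp [hf, hg]⟩
  exact (Measurable.of_discrete (f := fun p : ℕ × ℕ => Nat.pair p.1 p.2)).comp (hc.prodMk hd)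

lemma CountablyValued.glue {α : Type*} {c : Ω → ℕ} (hc : Measurable c) {f : ℕ → Ω → α}
    (hf : ∀ i, CountablyValued (f i)) : CountablyValued fun ω => f (c ω) ω := by
  choose d a hd hf using fun i => countablyValued_iff.1 (hf i)
  refine countablyValued_iff.2 ⟨fun ω => Nat.pair (c ω) (d (c ω) ω),
    fun n => a n.unpair.1 n.unpair.2, ?_, fun ω => by simp [hf]⟩
  have h : Measurable fun p : ℕ × Ω => Nat.pair p.1 (d p.1 p.2) :=
    measurable_from_prod_countable_right fun i =>
      (measurable_from_top (f := fun k : ℕ => Nat.pair i k)).comp (hd i)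
  exact h.comp (hc.prodMk measurable_id)

lemma CountablyValued.stronglyMeasurable {X : Type*} [TopologicalSpace X] {f : Ω → X}
    (hf : CountablyValued f) : StronglyMeasurable f := by
  obtain ⟨c, a, hc, hf⟩ := countablyValued_iff.1 hf
  rw [show f = a ∘ c from funext hf]
  exact (StronglyMeasurable.of_discrete (f := a)).comp_measurable hc

lemma PMeasurable.aestronglyMeasurable {X : Type*} [NormedAddCommGroup X] {μ : Measure Ω}
    {f : Ω → X} (hf : PMeasurable μ f) : AEStronglyMeasurable f μ := by
  obtain ⟨g, hg, hlim⟩ := hf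
  refine aestronglyMeasurable_of_tendsto_ae atTop
    (fun n => (hg n).stronglyMeasurable.aestronglyMeasurable) ?_
  choose N hN using fun k : ℕ => hlim (1 / (k + 1)) Nat.one_div_pos_of_nat
  have hall : ∀ᵐ ω ∂μ, ∀ k, ∀ n ≥ N k, ‖g n ω - f ω‖ ≤ 1 / (k + 1) :=
    ae_all_iff.2 fun k => ae_all_iff.2 fun n => by
      by_cases h : n ≥ N k
      · filter_upwards [hN k n h] with ω hω _ using hω
      · exact .of_forall fun ω h' => absurd h' h
  filter_upwards [hall] with ω hω
  refine Metric.tendsto_atTop.2 fun ε hε => ?_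
  obtain ⟨k, hk⟩ := exists_nat_one_div_lt hε
  exact ⟨N k, fun n hn => by rw [dist_eq_norm]; exact (hω k n hn).trans_lt hk⟩

/-! ### Excess and approximate selections -/

lemma IsCB.infDist_le_excess {X : Type*} [NormedAddCommGroup X] {A B : Set X} (hA : IsCB A)
    (hB : IsCB B) {x : X} (hx : x ∈ A) : infDist x B ≤ excess A B := by
  refine le_csSup ?_ (Set.mem_image_of_mem _ hx)
  obtain ⟨b, hb⟩ := hB.1
  obtain ⟨R, hR⟩ := hA.2.2.subset_closedBall b
  refine ⟨R, ?_⟩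
  rintro _ ⟨a, ha, rfl⟩
  exact (infDist_le_dist_of_mem hb).trans (hR ha)

lemma IsCB.infDist_le_infDist_add_excess {X : Type*} [NormedAddCommGroup X] {A B : Set X}
    (hA : IsCB A) (hB : IsCB B) (x : X) : infDist x B ≤ infDist x A + excess A B := by
  refine le_of_forall_pos_le_add fun ε hε => ?_
  obtain ⟨a, ha, hxa⟩ := (infDist_lt_iff hA.1).1 (lt_add_of_pos_right (infDist x A) hε)
  linarith [hA.infDist_le_excess hB ha, infDist_le_infDist_add_dist (s := B) (x := x) (y := a)]

lemma exists_near_map {X : Type*} [NormedAddCommGroup X] (ε : ℝ) (hε : 0 < ε) :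
    ∃ φ : X → Set X → X, ∀ x A, A.Nonempty →
      φ x A ∈ A ∧ dist x (φ x A) ≤ infDist x A + ε := by
  have h : ∀ (x : X) (A : Set X), ∃ y, A.Nonempty → y ∈ A ∧ dist x y ≤ infDist x A + ε := by
    intro x A
    by_cases hA : A.Nonempty
    · obtain ⟨y, hy, hxy⟩ := (infDist_lt_iff hA).1 (lt_add_of_pos_right (infDist x A) hε)
      exact ⟨y, fun _ => ⟨hy, hxy.le⟩⟩
    · exact ⟨0, fun h => absurd h hA⟩
  choose φ hφ using h
  exact ⟨φ, hφ⟩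

/-- A countably-valued approximate selection of a strongly measurable map is uniformly close to a
measurable selection. -/
theorem SMeasurableSet.exists_selection_near {X : Type*} [NormedAddCommGroup X] [CompleteSpace X]
    {μ : Measure Ω} {F : Ω → Set X} (hF : ∀ ω, IsCB (F ω)) (hFm : SMeasurableSet μ F)
    {u : Ω → X} (hu : CountablyValued u) {δ : ℝ} (hδ : 0 < δ) (huF : ∀ᵐ ω ∂μ, infDist (u ω) (F ω) ≤ δ) :
    ∃ f : Ω → X, PMeasurable μ f ∧ (∀ᵐ ω ∂μ, f ω ∈ F ω) ∧ ∀ᵐ ω ∂μ, ‖f ω - u ω‖ ≤ 6 * δ := by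
  obtain ⟨G, hGc, hGB, hG⟩ := hFm
  have hpos : ∀ k : ℕ, 0 < δ / 2 ^ k := fun k => by positivity
  choose N hN using fun k : ℕ => hG (δ / 2 ^ k) (hpos k)
  choose φ hφ using fun k : ℕ => exists_near_map (X := X) (δ / 2 ^ k) (hpos k)
  let f : ℕ → Ω → X := fun k => Nat.rec u (fun k v ω => φ k (v ω) (G (N (k + 1)) ω)) k
  have hfs : ∀ k ω, f (k + 1) ω = φ k (f k ω) (G (N (k + 1)) ω) := fun k ω => rfl
  have hfc : ∀ k, CountablyValued (f k) := by
    intro k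
    induction k with
    | zero => exact hu
    | succ k ih => exact ih.map₂ (hGc _) (φ k)
  have hGF : ∀ᵐ ω ∂μ, ∀ k, hdist (G (N k) ω) (F ω) ≤ δ / 2 ^ k :=
    ae_all_iff.2 fun k => hN k (N k) le_rfl
  have hdist_f : ∀ᵐ ω ∂μ, ∀ k, infDist (f k ω) (F ω) ≤ δ / 2 ^ k := by
    filter_upwards [hGF, huF] with ω hω h0 k
    cases k with
    | zero => simpa [f] using h0
    | succ k =>
      have hmem : f (k + 1) ω ∈ G (N (k + 1)) ω := (hφ k _ _ (hGB _ ω).1).1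
      exact ((hGB _ ω).infDist_le_excess (hF ω) hmem).trans ((le_max_left _ _).trans (hω _))
  have hstep : ∀ᵐ ω ∂μ, ∀ k, dist (f k ω) (f (k + 1) ω) ≤ 6 * δ / 2 / 2 ^ k := by
    filter_upwards [hGF, hdist_f] with ω hω hd k
    have h1 := (hφ k (f k ω) _ (hGB (N (k + 1)) ω).1).2
    have h2 := (hF ω).infDist_le_infDist_add_excess (hGB (N (k + 1)) ω) (f k ω)
    have h3 := (le_max_right _ _).trans (hω (k + 1))
    have h4 : δ / 2 ^ (k + 1) ≤ δ / 2 ^ k := by gcongr <;> simp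
    have h5 : 6 * δ / 2 / 2 ^ k = 3 * (δ / 2 ^ k) := by ring
    rw [hfs, h5]
    linarith [hd k]
  have hlim : ∀ᵐ ω ∂μ, Tendsto (fun k => f k ω) atTop (𝓝 (limUnder atTop fun k => f k ω)) := by
    filter_upwards [hstep] with ω hω
    exact (cauchySeq_of_le_geometric_two hω).tendsto_limUnder
  have hzero : ∀ C : ℝ, Tendsto (fun n : ℕ => C / 2 ^ n) atTop (𝓝 0) := fun C =>
    tendsto_const_nhds.div_atTop (tendsto_pow_atTop_atTop_of_one_lt one_lt_two)
  refine ⟨fun ω => limUnder atTop fun k => f k ω, ⟨f, hfc, fun ε hε => ?_⟩, ?_, ?_⟩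
  · obtain ⟨M, hM⟩ := eventually_atTop.1 ((hzero (6 * δ)).eventually (ge_mem_nhds hε))
    refine ⟨M, fun n hn => ?_⟩
    filter_upwards [hstep, hlim] with ω hω hl
    rw [← dist_eq_norm]
    exact (dist_le_of_le_geometric_two_of_tendsto hω hl n).trans (hM n hn)
  · filter_upwards [hlim, hdist_f] with ω hl hd
    rw [(hF ω).2.1.mem_iff_infDist_zero (hF ω).1]
    have := ((continuous_infDist_pt (F ω)).tendsto _).comp hl
    exact le_antisymm (le_of_tendsto_of_tendsto' this (hzero δ) hd) infDist_nonneg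
  · filter_upwards [hstep, hlim] with ω hω hl
    rw [← dist_eq_norm, dist_comm]
    exact dist_le_of_le_geometric_two_of_tendsto₀ hω hl

/-! ### Integrals of countably-valued selections -/

lemma CountablyValued.integrable {X : Type*} [NormedAddCommGroup X] {μ : Measure Ω}
    [IsFiniteMeasure μ] {f : Ω → X} (hf : CountablyValued f) {A : Set X}
    (hA : Bornology.IsBounded A) (hfA : ∀ ω, f ω ∈ A) :
    Integrable f μ := by
  obtain ⟨C, hC⟩ := hA.exists_norm_le
  exact .of_bound hf.stronglyMeasurable.aestronglyMeasurable C (.of_forall fun ω => hC _ (hfA ω))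

/-- Over an atomless measure, the average of `A`-valued maps attains every point of the convex
hull of `A`. -/
theorem Atomless.exists_setIntegral_eq_of_mem_convexHull {μ : Measure Ω} [IsFiniteMeasure μ]
    (hμ : Atomless μ) {A : Set E} (hA : Bornology.IsBounded A) {z : E}
    (hz : z ∈ convexHull ℝ A) {S : Set Ω} (hS : MeasurableSet S) :
    ∃ f : Ω → E, CountablyValued f ∧ (∀ ω, f ω ∈ A) ∧ ∫ ω in S, f ω ∂μ = μ.real S • z := by
  suffices h : convexHull ℝ A ⊆ {z | ∀ S, MeasurableSet S → ∃ f : Ω → E, CountablyValued f ∧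
      (∀ ω, f ω ∈ A) ∧ ∫ ω in S, f ω ∂μ = μ.real S • z} from h hz S hS
  refine convexHull_min (fun a ha S _ => ⟨fun _ => a, .const a, fun _ => ha, by simp⟩) ?_
  intro x hx y hy a b ha hb hab S hS
  obtain ⟨B, hBS, hB, hBm⟩ := hμ.exists_subset_real_eq hS (t := a * μ.real S) (by positivity)
    (mul_le_of_le_one_left measureReal_nonneg (by linarith))
  obtain ⟨f, hf, hfA, hfi⟩ := hx B hB
  obtain ⟨g, hg, hgA, hgi⟩ := hy (S \ B) (hS.diff hB)
  classical
  have hc : Measurable fun ω => if ω ∈ B then 0 else 1 :=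
    Measurable.ite hB measurable_const (measurable_const (a := (1 : ℕ)))
  set k : Ω → E := fun ω => if ω ∈ B then f ω else g ω with hk
  have hkc : CountablyValued k := by
    convert CountablyValued.glue hc (f := fun i => if i = 0 then f else g)
      (fun i => by split_ifs <;> assumption) using 2 with ω
    by_cases h : ω ∈ B <;> simp [hk, h]
  have hkA : ∀ ω, k ω ∈ A := fun ω => by
    by_cases h : ω ∈ B <;> simp [hk, h, hfA, hgA]
  have hki : Integrable k μ := hkc.integrable hA hkA
  refine ⟨k, hkc, hkA, ?_⟩
  have hd : μ.real (S \ B) = b * μ.real S := by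
    rw [measureReal_sdiff hBS hB, hBm]
    linear_combination -(μ.real S) * hab
  have h1 : ∫ ω in B, k ω ∂μ = ∫ ω in B, f ω ∂μ :=
    setIntegral_congr_fun hB fun ω h => if_pos h
  have h2 : ∫ ω in S \ B, k ω ∂μ = ∫ ω in S \ B, g ω ∂μ :=
    setIntegral_congr_fun (hS.diff hB) fun ω h => if_neg h.2
  rw [← Set.union_sdiff_cancel hBS, setIntegral_union Set.disjoint_sdiff_right (hS.diff hB)
    hki.integrableOn hki.integrableOn, h1, h2, hfi, hgi, hd, hBm, Set.union_sdiff_cancel hBS,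
    smul_add, smul_smul, smul_smul, mul_comm a, mul_comm b]

lemma IsCB.exists_mem_convexHull_dist_le {X : Type*} [NormedAddCommGroup X] [NormedSpace ℝ X]
    {A B : Set X} (hA : IsCB A) (hB : IsCB B) {δ : ℝ}
    (hδ : 0 < δ) (hAB : excess A B ≤ δ) {x : X} (hx : x ∈ closure (convexHull ℝ A)) :
    ∃ z ∈ convexHull ℝ B, dist x z ≤ 3 * δ := by
  have hsub : convexHull ℝ A ⊆ thickening (2 * δ) (convexHull ℝ B) := by
    refine convexHull_min (fun a ha => ?_) ((convex_convexHull ℝ B).thickening _)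
    obtain ⟨b, hb, hab⟩ := (infDist_lt_iff hB.1).1
      (((hA.infDist_le_excess hB ha).trans hAB).trans_lt (show δ < 2 * δ by linarith))
    exact mem_thickening_iff.2 ⟨b, subset_convexHull ℝ B hb, hab⟩
  obtain ⟨y, hy, hxy⟩ := Metric.mem_closure_iff.1 hx δ hδ
  obtain ⟨z, hz, hyz⟩ := mem_thickening_iff.1 (hsub hy)
  exact ⟨z, hz, by linarith [dist_triangle x y z]⟩

/-- If a countably-valued map `v` is a.e. within `r` of the convex hull of a countably-valued
set-valued map `G`, then `G` has a countably-valued selection whose integral is within `r` of that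
of `v`. -/
theorem Atomless.exists_selection_integral_near {μ : Measure Ω} [IsProbabilityMeasure μ]
    (hμ : Atomless μ) {G : Ω → Set E} (hG : CountablyValued G) (hGB : ∀ ω, IsCB (G ω))
    {v : Ω → E} (hv : CountablyValued v) {r : ℝ}
    (hr : ∀ᵐ ω ∂μ, ∃ z ∈ convexHull ℝ (G ω), ‖v ω - z‖ ≤ r) :
    ∃ u : Ω → E, CountablyValued u ∧ (∀ ω, u ω ∈ G ω) ∧
      (Integrable u μ → Integrable v μ → ‖∫ ω, u ω ∂μ - ∫ ω, v ω ∂μ‖ ≤ r) := by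
  obtain ⟨c, a, hc, hca⟩ := countablyValued_iff.1 (hG.map₂ hv Prod.mk)
  have hpm : ∀ i, MeasurableSet (c ⁻¹' {i}) := fun i => hc (measurableSet_singleton i)
  have piece : ∀ i, ∃ w : Ω → E, CountablyValued w ∧ (∀ ω, c ω = i → w ω ∈ G ω) ∧
      ‖∫ ω in c ⁻¹' {i}, w ω ∂μ - μ.real (c ⁻¹' {i}) • (a i).2‖ ≤ r * μ.real (c ⁻¹' {i}) := by
    intro i
    have hGi : ∀ ω, c ω = i → G ω = (a i).1 := fun ω h => by rw [← h, ← hca]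
    have hvi : ∀ ω, c ω = i → v ω = (a i).2 := fun ω h => by rw [← h, ← hca]
    by_cases h0 : μ (c ⁻¹' {i}) = 0
    · choose w hw using fun ω => (hGB ω).1
      have h0' : μ.real (c ⁻¹' {i}) = 0 := by simp [measureReal_def, h0]
      by_cases hne : ∃ ω₀, c ω₀ = i
      · obtain ⟨ω₀, h₀⟩ := hne
        refine ⟨fun _ => w ω₀, .const _, fun ω h => ?_, by simp [h0']⟩
        rw [hGi ω h, ← hGi ω₀ h₀]
        exact hw ω₀
      · exact ⟨fun _ => 0, .const _, fun ω h => absurd ⟨ω, h⟩ hne, by simp [h0']⟩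
    · obtain ⟨ω₀, h₀, z, hz, hvz⟩ := ((frequently_ae_mem_iff.2 h0).and_eventually hr).exists
      obtain ⟨w, hw, hwA, hwi⟩ :=
        hμ.exists_setIntegral_eq_of_mem_convexHull (hGB ω₀).2.2 hz (hpm i)
      refine ⟨w, hw, fun ω h => ?_, ?_⟩
      · rw [hGi ω h, ← hGi ω₀ h₀]
        exact hwA ω
      · rw [hwi, ← smul_sub, norm_smul, Real.norm_of_nonneg measureReal_nonneg, mul_comm,
          norm_sub_rev, ← hvi ω₀ h₀]
        gcongr
  choose w hw hwG hwi using piece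
  refine ⟨fun ω => w (c ω) ω, .glue hc hw, fun ω => hwG _ ω rfl, fun hu hv' => ?_⟩
  have hd : Pairwise (Function.onFun Disjoint fun i => c ⁻¹' {i}) :=
    fun i j hij => Disjoint.preimage _ (by simpa using hij)
  have hU : ⋃ i, c ⁻¹' {i} = Set.univ := by ext ω; simp
  have hsum := hasSum_integral_iUnion hpm hd (hu.sub hv').integrableOn
  have hone := hasSum_integral_iUnion (μ := μ) (f := fun _ => r) hpm hd
    (integrable_const r).integrableOn
  rw [hU, setIntegral_univ] at hsum hone
  rw [integral_const, probReal_univ, one_smul] at hone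
  rw [← integral_sub hu hv']
  refine hsum.norm_le_of_bounded hone fun i => ?_
  have h1 : ∫ ω in c ⁻¹' {i}, w (c ω) ω ∂μ = ∫ ω in c ⁻¹' {i}, w i ω ∂μ :=
    setIntegral_congr_fun (hpm i) fun ω h => by rw [show c ω = i from h]
  have h2 : ∫ ω in c ⁻¹' {i}, v ω ∂μ = μ.real (c ⁻¹' {i}) • (a i).2 := by
    rw [← setIntegral_const]
    exact setIntegral_congr_fun (hpm i) fun ω h => by
      rw [← show c ω = i from h, ← hca]
  have h3 : ∫ ω in c ⁻¹' {i}, (fun ω => w (c ω) ω - v ω) ω ∂μ =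
      ∫ ω in c ⁻¹' {i}, w i ω ∂μ - μ.real (c ⁻¹' {i}) • (a i).2 := by
    rw [integral_sub hu.integrableOn hv'.integrableOn, h1, h2]
  rw [setIntegral_const, smul_eq_mul, mul_comm]
  exact h3 ▸ hwi i

/-! ### The Aumann integral -/

lemma Integrable.of_ae_norm_sub_le {X : Type*} [NormedAddCommGroup X] {μ : Measure Ω}
    [IsFiniteMeasure μ] {f u : Ω → X} (hf : Integrable f μ) (hu : CountablyValued u) {C : ℝ}
    (h : ∀ᵐ ω ∂μ, ‖u ω - f ω‖ ≤ C) : Integrable u μ := by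
  have hd : Integrable (fun ω => u ω - f ω) μ :=
    .of_bound (hu.stronglyMeasurable.aestronglyMeasurable.sub hf.1) C h
  exact (hd.add hf).congr (.of_forall fun ω => sub_add_cancel _ _)

lemma PMeasurable.integrable_of_selection {X : Type*} [NormedAddCommGroup X] {μ : Measure Ω}
    {F : Ω → Set X} (hF : ∀ ω, IsCB (F ω))
    (hFi : ∫⁻ ω, ENNReal.ofReal (sSup ((fun x => ‖x‖) '' F ω)) ∂μ < ⊤) {f : Ω → X}
    (hf : PMeasurable μ f) (hfF : ∀ᵐ ω ∂μ, f ω ∈ F ω) : Integrable f μ := by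
  refine ⟨hf.aestronglyMeasurable, (lintegral_mono_ae ?_).trans_lt hFi⟩
  filter_upwards [hfF] with ω hω
  obtain ⟨C, hC⟩ := (hF ω).2.2.exists_norm_le
  rw [← ofReal_norm]
  refine ENNReal.ofReal_le_ofReal (le_csSup ⟨C, ?_⟩ (Set.mem_image_of_mem _ hω))
  rintro _ ⟨x, hx, rfl⟩
  exact hC x hx

lemma norm_integral_sub_le_of_ae {X : Type*} [NormedAddCommGroup X] [NormedSpace ℝ X]
    {μ : Measure Ω} [IsProbabilityMeasure μ] {f g : Ω → X}
    (hf : Integrable f μ) (hg : Integrable g μ) {C : ℝ} (h : ∀ᵐ ω ∂μ, ‖f ω - g ω‖ ≤ C) :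
    ‖∫ ω, f ω ∂μ - ∫ ω, g ω ∂μ‖ ≤ C := by
  rw [← integral_sub hf hg]
  simpa using norm_integral_le_of_norm_le_const h

/-- The integral of a selection of `ω ↦ co̅ F(ω)` is approximated by integrals of selections
of `F`. -/
theorem exists_selection_norm_integral_sub_le {μ : Measure Ω} [IsProbabilityMeasure μ]
    (hμ : Atomless μ) {F : Ω → Set E} (hF : ∀ ω, IsCB (F ω)) (hFm : SMeasurableSet μ F)
    (hFi : ∫⁻ ω, ENNReal.ofReal (sSup ((fun x => ‖x‖) '' F ω)) ∂μ < ⊤) {g : Ω → E}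
    (hg : PMeasurable μ g) (hgF : ∀ᵐ ω ∂μ, g ω ∈ closure (convexHull ℝ (F ω)))
    (hgi : Integrable g μ) {δ : ℝ} (hδ : 0 < δ) :
    ∃ f : Ω → E, PMeasurable μ f ∧ (∀ᵐ ω ∂μ, f ω ∈ F ω) ∧ Integrable f μ ∧
      ‖∫ ω, f ω ∂μ - ∫ ω, g ω ∂μ‖ ≤ 11 * δ := by
  obtain ⟨G, hGc, hGB, hGF⟩ := id hFm
  obtain ⟨N, hN⟩ := hGF δ hδ
  obtain ⟨v, hvc, hvg⟩ := hg
  obtain ⟨M, hM⟩ := hvg δ hδ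
  have hr : ∀ᵐ ω ∂μ, ∃ z ∈ convexHull ℝ (G N ω), ‖v M ω - z‖ ≤ 4 * δ := by
    filter_upwards [hN N le_rfl, hM M le_rfl, hgF] with ω h1 h2 h3
    obtain ⟨z, hz, hgz⟩ := (hF ω).exists_mem_convexHull_dist_le (hGB N ω) hδ
      ((le_max_right _ _).trans h1) h3
    rw [dist_eq_norm] at hgz
    exact ⟨z, hz, by linarith [norm_sub_le_norm_sub_add_norm_sub (v M ω) (g ω) z]⟩
  obtain ⟨u, huc, huG, hui⟩ :=
    hμ.exists_selection_integral_near (hGc N) (hGB N) (hvc M) hr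
  have huF : ∀ᵐ ω ∂μ, infDist (u ω) (F ω) ≤ δ := by
    filter_upwards [hN N le_rfl] with ω h1
    exact ((hGB N ω).infDist_le_excess (hF ω) (huG ω)).trans ((le_max_left _ _).trans h1)
  obtain ⟨f, hf, hfF, hfu⟩ := hFm.exists_selection_near hF huc hδ huF
  have hfi := hf.integrable_of_selection hF hFi hfF
  have hu' : Integrable u μ :=
    Integrable.of_ae_norm_sub_le hfi huc (hfu.mono fun ω h => by rwa [norm_sub_rev])
  have hv' : Integrable (v M) μ := Integrable.of_ae_norm_sub_le hgi (hvc M) (hM M le_rfl)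
  refine ⟨f, hf, hfF, hfi, ?_⟩
  linarith [norm_integral_sub_le_of_ae hfi hu' hfu, hui hu' hv',
    norm_integral_sub_le_of_ae hv' hgi (hM M le_rfl),
    norm_sub_le_norm_sub_add_norm_sub (∫ ω, f ω ∂μ) (∫ ω, u ω ∂μ) (∫ ω, g ω ∂μ),
    norm_sub_le_norm_sub_add_norm_sub (∫ ω, u ω ∂μ) (∫ ω, v M ω ∂μ) (∫ ω, g ω ∂μ)]

/-- Proposition 5.6: for a strongly measurable, integrably bounded `F : Ω → ℭ(E)` over
a complete atomless probability space, the Aumann integral of `F` equals the Aumann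
integral of `ω ↦ co̅ F(ω)`. -/
theorem aumann_integral_eq_convexified (μ : Measure Ω) [IsProbabilityMeasure μ]
    [μ.IsComplete] (hμa : Atomless μ)
    (F : Ω → Set E) (hF : ∀ ω, IsCB (F ω)) (hFm : SMeasurableSet μ F)
    (hFi : ∫⁻ ω, ENNReal.ofReal (sSup ((fun x => ‖x‖) '' F ω)) ∂μ < ⊤) :
    closure {x : E | ∃ f : Ω → E, PMeasurable μ f ∧ (∀ᵐ ω ∂μ, f ω ∈ F ω) ∧
        Integrable f μ ∧ x = ∫ ω, f ω ∂μ} =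
      closure {x : E | ∃ g : Ω → E, PMeasurable μ g ∧
        (∀ᵐ ω ∂μ, g ω ∈ closure (convexHull ℝ (F ω))) ∧
        Integrable g μ ∧ x = ∫ ω, g ω ∂μ} := by
  apply subset_antisymm
  · refine closure_mono ?_
    rintro x ⟨f, hf, hfF, hfi, rfl⟩
    exact ⟨f, hf, hfF.mono fun ω h => subset_closure (subset_convexHull ℝ _ h), hfi, rfl⟩
  · refine closure_minimal ?_ isClosed_closure
    rintro x ⟨g, hg, hgF, hgi, rfl⟩
    refine Metric.mem_closure_iff.2 fun ε hε => ?_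
    obtain ⟨f, hf, hfF, hfi, h⟩ := exists_selection_norm_integral_sub_le hμa hF hFm hFi hg hgF hgi
      (δ := ε / 12) (by positivity)
    refine ⟨_, ⟨f, hf, hfF, hfi, rfl⟩, ?_⟩
    rw [dist_comm, dist_eq_norm]
    linarith
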